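/- Let L be a countable first-order language, T a complete consistent L-theory, λ a cardinal with λ < cov K, and for each i < λ let Γ_i be a non-principal type over T in finitely many free variables. Then T has a model that omits every Γ_i, i.e., a model M such that for each i < λ no tuple of M satisfies every formula in Γ_i. -/

import Mathlib

open FirstOrder FirstOrder.Language

universe u v

/-- `cov K`: the least cardinality of a family of nowhere dense subsets of `ℝ`
whose union is all of `ℝ`. -/
noncomputable def covK : Cardinal :=
  sInf {c : Cardinal | ∃ (ι : Type) (A : ι → Set ℝ),
    (∀ i, IsNowhereDense (A i)) ∧ (⋃ i, A i) = Set.univ ∧ c = Cardinal.mk ι}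

/-- A formula `φ(x₀,…,x_{n−1})` is consistent with `T` if some `n`-tuple in some
model of `T` satisfies it. -/
def ConsistentWith {L : FirstOrder.Language.{u, v}} (T : L.Theory) {n : ℕ}
    (φ : L.Formula (Fin n)) : Prop :=
  ∃ (M : Theory.ModelType.{u, v, max u v} T) (v : Fin n → M), φ.Realize v

/-- A set `Γ` of formulas in the free variables `x₀,…,x_{n−1}` is non-principal
over `T` if for every formula `φ` consistent with `T` there is `γ ∈ Γ` such that
`φ ⊓ ∼γ` is consistent with `T`. -/
def NonPrincipal {L : FirstOrder.Language.{u, v}} (T : L.Theory) {n : ℕ}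
    (Γ : Set (L.Formula (Fin n))) : Prop :=
  ∀ φ : L.Formula (Fin n), ConsistentWith T φ →
    ∃ γ ∈ Γ, ConsistentWith T (φ ⊓ γ.not)

theorem aleph0_lt_covK : Cardinal.aleph0 < covK := by
  have hne : {c : Cardinal | ∃ (ι : Type) (A : ι → Set ℝ),
      (∀ i, IsNowhereDense (A i)) ∧ (⋃ i, A i) = Set.univ ∧ c = Cardinal.mk ι}.Nonempty := by
    refine ⟨_, ℝ, fun x => {x}, fun x => ?_, ?_, rfl⟩
    · simp [IsNowhereDense]
    · exact Set.iUnion_of_singleton ℝ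
  obtain ⟨ι, A, hA, hU, hc⟩ := csInf_mem hne
  by_contra h
  have hι : Cardinal.mk ι ≤ Cardinal.aleph0 := hc ▸ not_lt.1 h
  have : Countable ι := Cardinal.mk_le_aleph0_iff.1 hι
  obtain ⟨i, hi⟩ := nonempty_interior_of_iUnion_of_closed (f := fun i => closure (A i))
    (fun i => isClosed_closure)
    (Set.univ_subset_iff.1 (hU ▸ Set.iUnion_mono fun i => subset_closure))
  exact hi.ne_empty (hA i)

theorem exists_forall_notMem_of_lt_covK {ι : Type} (hι : Cardinal.mk ι < covK)
    (A : ι → Set ℝ) (hA : ∀ i, IsNowhereDense (A i)) : ∃ x, ∀ i, x ∉ A i := by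
  by_contra! h
  exact notMem_of_lt_csInf hι (OrderBot.bddBelow _)
    ⟨ι, A, hA, Set.eq_univ_of_forall fun x => Set.mem_iUnion.2 (h x), rfl⟩

section DyadicSequences

variable {P : Type*} [Preorder P]

open Classical in
/-- Read off the binary digits of `k / 2 ^ m`: at a digit `1` in position `m`, move from the
current element of `P` to `e m` if that is an extension; otherwise stay. -/
noncomputable def dyadicPath (e : ℕ → P) : ℕ → ℤ → P
  | 0, _ => e 0
  | m + 1, k =>
    if k % 2 = 1 ∧ e m ≤ dyadicPath e m (k / 2) then e m else dyadicPath e m (k / 2)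

theorem dyadicPath_succ_le (e : ℕ → P) (m : ℕ) (k : ℤ) :
    dyadicPath e (m + 1) k ≤ dyadicPath e m (k / 2) := by
  rw [dyadicPath]
  split_ifs with h
  exacts [h.2, le_rfl]

theorem dyadicPath_add (e : ℕ → P) (m j : ℕ) (k : ℤ) :
    dyadicPath e (m + j) (k * 2 ^ j) = dyadicPath e m k := by
  induction j with
  | zero => simp
  | succ j ih =>
    have h1 : k * 2 ^ (j + 1) / 2 = k * 2 ^ j := by rw [pow_succ, ← mul_assoc]; omega
    have h2 : ¬ k * 2 ^ (j + 1) % 2 = 1 := by rw [pow_succ, ← mul_assoc]; omega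
    rw [← add_assoc, dyadicPath, h1, if_neg (fun h => h2 h.1), ih]

theorem floor_two_pow_succ_mul_div_two (m : ℕ) (x : ℝ) :
    ⌊2 ^ (m + 1) * x⌋ / 2 = ⌊2 ^ m * x⌋ := by
  have := Int.floor_div_natCast (2 ^ (m + 1) * x) 2
  push_cast at this
  rw [← this]
  congr 1
  ring

theorem antitone_dyadicPath_floor (e : ℕ → P) (x : ℝ) :
    Antitone fun m => dyadicPath e m ⌊2 ^ m * x⌋ :=
  antitone_nat_of_succ_le fun m => by
    rw [← floor_two_pow_succ_mul_div_two m x]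
    exact dyadicPath_succ_le e m _

theorem isNowhereDense_dyadicPath_notMem {e : ℕ → P} (he : ∀ p m, ∃ m' ≥ m, e m' = p)
    {D : Set P} (hD : ∀ p, ∃ q ≤ p, q ∈ D) :
    IsNowhereDense {x : ℝ | ∀ m, dyadicPath e m ⌊2 ^ m * x⌋ ∉ D} := by
  set A := {x : ℝ | ∀ m, dyadicPath e m ⌊2 ^ m * x⌋ ∉ D} with hAdef
  by_contra hA
  obtain ⟨x, hx⟩ := Set.nonempty_iff_ne_empty.2 hA
  obtain ⟨ε, hε, hball⟩ := Metric.isOpen_iff.1 isOpen_interior x hx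
  obtain ⟨m, hm⟩ := exists_pow_lt_of_lt_one hε (by norm_num : (1 / 2 : ℝ) < 1)
  obtain ⟨q, hqp, hqD⟩ := hD (dyadicPath e m ⌊2 ^ m * x⌋)
  obtain ⟨m', hm', rfl⟩ := he q m
  obtain ⟨j, rfl⟩ := Nat.exists_eq_add_of_le hm'
  set k := ⌊2 ^ m * x⌋ with hk
  have h2m : (0 : ℝ) < 2 ^ m := by positivity
  have h2j : (0 : ℝ) < 2 ^ j := by positivity
  have hpow : (2 : ℝ) ^ (m + j + 1) = 2 ^ m * 2 ^ j * 2 := by ring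
  have hpath : dyadicPath e (m + j + 1) (k * 2 ^ j * 2 + 1) = e (m + j) := by
    have h1 : (k * 2 ^ j * 2 + 1) / 2 = k * 2 ^ j := by omega
    rw [dyadicPath, h1, dyadicPath_add, if_pos ⟨by omega, hqp⟩]
  -- the open dyadic interval with index `k * 2 ^ j * 2 + 1` misses `A`
  set a : ℝ := (k * 2 ^ j * 2 + 1) / 2 ^ (m + j + 1) with ha
  set b : ℝ := (k * 2 ^ j * 2 + 2) / 2 ^ (m + j + 1) with hb
  have hdisj : Disjoint (Set.Ioo a b) A := by
    rw [Set.disjoint_left]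
    rintro y ⟨hay, hyb⟩ hyA
    refine hyA (m + j + 1) ?_
    have hfl : ⌊2 ^ (m + j + 1) * y⌋ = k * 2 ^ j * 2 + 1 := by
      rw [Int.floor_eq_iff]
      rw [ha, div_lt_iff₀ (by positivity)] at hay
      rw [hb, lt_div_iff₀ (by positivity)] at hyb
      push_cast
      constructor <;> linarith
    rw [hfl, hpath]
    exact hqD
  have hdisj' : Disjoint (Set.Ioo a b) (closure A) := hdisj.closure_right isOpen_Ioo
  have hab : a < b := by rw [ha, hb]; gcongr; norm_num
  obtain ⟨y, hy⟩ := exists_between hab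
  refine Set.disjoint_left.1 hdisj' hy (interior_subset (hball ?_))
  have hkx : (k : ℝ) ≤ 2 ^ m * x := Int.floor_le _
  have hxk : 2 ^ m * x < k + 1 := Int.lt_floor_add_one _
  have h1j : (1 : ℝ) ≤ 2 ^ j := one_le_pow₀ (by norm_num)
  have hay : (k : ℝ) < 2 ^ m * y := by
    have := hy.1
    rw [ha, div_lt_iff₀ (by positivity), hpow] at this
    by_contra! hcon
    nlinarith
  have hyb : 2 ^ m * y < k + 1 := by
    have := hy.2
    rw [hb, lt_div_iff₀ (by positivity), hpow] at this
    by_contra! hcon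
    nlinarith
  rw [one_div, inv_pow, inv_lt_iff_one_lt_mul₀ h2m] at hm
  rw [Metric.mem_ball, Real.dist_eq, abs_lt]
  constructor <;> nlinarith

/-- Fewer than `cov K` dense subsets of a countable preorder are all met by one descending
sequence. -/
theorem exists_antitone_forall_mem_of_lt_covK [Countable P] [Nonempty P] {ι : Type}
    (hι : Cardinal.mk ι < covK) (D : ι → Set P) (hD : ∀ i p, ∃ q ≤ p, q ∈ D i) :
    ∃ s : ℕ → P, Antitone s ∧ ∀ i, ∃ m, s m ∈ D i := by
  obtain ⟨f, hf⟩ := exists_surjective_nat P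
  have he : ∀ p m, ∃ m' ≥ m, f (Nat.unpair m').1 = p := fun p m => by
    obtain ⟨a, rfl⟩ := hf p
    exact ⟨Nat.pair a m, Nat.right_le_pair a m, by simp⟩
  obtain ⟨x, hx⟩ := exists_forall_notMem_of_lt_covK hι _
    fun i => isNowhereDense_dyadicPath_notMem he (hD i)
  refine ⟨_, antitone_dyadicPath_floor (fun m => f (Nat.unpair m).1) x, fun i => ?_⟩
  simpa using hx i

/-- A version of `exists_antitone_forall_mem_of_lt_covK` with countably many dense sets for each
index and countably many further ones. -/
theorem exists_antitone_forall_mem_of_lt_covK' [Countable P] [Nonempty P] {ι : Type}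
    (hι : Cardinal.mk ι < covK) {κ : Type*} [Countable κ] [Nonempty κ] (E : κ → Set P)
    (hE : ∀ k p, ∃ q ≤ p, q ∈ E k) {β : ι → Type*} [∀ i, Countable (β i)] [∀ i, Nonempty (β i)]
    (D : ∀ i, β i → Set P) (hD : ∀ i b p, ∃ q ≤ p, q ∈ D i b) :
    ∃ s : ℕ → P, Antitone s ∧ (∀ k, ∃ m, s m ∈ E k) ∧ ∀ i b, ∃ m, s m ∈ D i b := by
  obtain ⟨f, hf⟩ := exists_surjective_nat κ
  choose g hg using fun i => exists_surjective_nat (β i)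
  have hcard : Cardinal.mk (Option ι × ℕ) < covK := by
    rw [Cardinal.mk_prod, Cardinal.mk_option]
    simp only [Cardinal.lift_id, Cardinal.mk_nat]
    refine (Cardinal.mul_le_max _ _).trans_lt (max_lt (max_lt ?_ aleph0_lt_covK) aleph0_lt_covK)
    exact Cardinal.add_lt_of_lt aleph0_lt_covK.le hι
      (Cardinal.one_lt_aleph0.trans aleph0_lt_covK)
  obtain ⟨s, hs, hmem⟩ := exists_antitone_forall_mem_of_lt_covK hcard
    (fun a => a.1.elim (E (f a.2)) fun i => D i (g i a.2)) (by
      rintro ⟨_ | i, n⟩ p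
      exacts [hE _ p, hD _ _ p])
  refine ⟨s, hs, fun k => ?_, fun i b => ?_⟩
  · obtain ⟨n, rfl⟩ := hf k
    exact hmem (none, n)
  · obtain ⟨n, rfl⟩ := hg i b
    exact hmem (some i, n)

end DyadicSequences

section Conditions

variable {L : FirstOrder.Language.{u, v}} (T : L.Theory)

/-- The models of `T` together with a sequence of elements. -/
abbrev PointedModel : Type (max u v + 1) :=
  Σ M : Theory.ModelType.{u, v, max u v} T, ℕ → M

/-- The pointed models in which the distinguished sequence satisfies `φ`. -/
def realizations (φ : L.Formula ℕ) : Set (PointedModel T) := {x | φ.Realize x.2}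

/-- The forcing conditions: nonempty sets of pointed models cut out by one formula. -/
abbrev HenkinCondition : Type (max u v + 1) :=
  {S : Set (PointedModel T) // S.Nonempty ∧ S ∈ Set.range (realizations T)}

variable {T}

theorem realize_congr_freeVarFinset {α M : Type*} [DecidableEq α] [L.Structure M]
    {φ : L.Formula α} {v w : α → M} (h : ∀ a ∈ φ.freeVarFinset, v a = w a) : φ.Realize v ↔ φ.Realize w := by
  have hv := BoundedFormula.realize_restrictFreeVar (φ := φ) (f := Subtype.val) (v := v)
    (xs := default) v fun _ => rfl
  have hw := BoundedFormula.realize_restrictFreeVar (φ := φ) (f := Subtype.val) (v := v)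
    (xs := default) w fun a => h a a.2
  exact hv.symm.trans hw

/-- Any condition can be refined by a formula compatible with it. -/
theorem HenkinCondition.exists_le (p : HenkinCondition T) (ψ : L.Formula ℕ) {x : PointedModel T}
    (hx : x ∈ p.1) (hψ : ψ.Realize x.2) : ∃ q ≤ p, ∀ y ∈ q.1, ψ.Realize y.2 := by
  obtain ⟨φ, hφ⟩ := p.2.2
  rw [← hφ] at hx
  exact ⟨⟨realizations T (φ ⊓ ψ), ⟨x, Formula.realize_inf.2 ⟨hx, hψ⟩⟩, _, rfl⟩,
    fun y hy => hφ ▸ (Formula.realize_inf.1 hy).1, fun y hy => (Formula.realize_inf.1 hy).2⟩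

theorem HenkinCondition.exists_le_witness (ψ : L.Formula (Option ℕ)) (p : HenkinCondition T) :
    ∃ q ≤ p, q ∈ {q : HenkinCondition T |
      (∀ x ∈ q.1, ∀ a, ¬ ψ.Realize fun o => o.elim a x.2) ∨
      ∃ k, ∀ x ∈ q.1, ψ.Realize fun o => o.elim (x.2 k) x.2} := by
  by_cases h : ∀ x ∈ p.1, ∀ a, ¬ ψ.Realize fun o => o.elim a x.2
  · exact ⟨p, le_rfl, Or.inl h⟩
  push Not at h
  obtain ⟨⟨M, v⟩, hx, a, ha⟩ := h
  obtain ⟨k, hk⟩ := Infinite.exists_notMem_finset (p.2.2.choose.freeVarFinset ∪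
    ψ.freeVarFinset.eraseNone)
  rw [Finset.mem_union, not_or, Finset.mem_eraseNone] at hk
  have hp := p.2.2.choose_spec
  have hx' : (⟨M, Function.update v k a⟩ : PointedModel T) ∈ p.1 := by
    rw [← hp] at hx ⊢
    refine (realize_congr_freeVarFinset fun b hb => ?_).1 hx
    have hbk : b ≠ k := fun h => hk.1 (h ▸ hb)
    simp [hbk]
  obtain ⟨q, hqp, hq⟩ := p.exists_le (ψ.relabel fun o => o.elim k id) hx' (by
    rw [Formula.realize_relabel]
    refine (realize_congr_freeVarFinset fun o ho => ?_).1 ha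
    cases o with
    | none => simp
    | some b =>
      have hb : b ≠ k := by
        rintro rfl
        exact hk.2 ho
      simp [hb])
  refine ⟨q, hqp, Or.inr ⟨k, fun x hx => ?_⟩⟩
  have := hq x hx
  rw [Formula.realize_relabel] at this
  convert this using 1
  funext o
  cases o <;> rfl

theorem HenkinCondition.exists_le_omits {n : ℕ} {Γ : Set (L.Formula (Fin n))}
    (hΓ : NonPrincipal T Γ) (w : Fin n → ℕ) (p : HenkinCondition T) :
    ∃ q ≤ p, q ∈ {q : HenkinCondition T | ∃ γ ∈ Γ, ∀ x ∈ q.1, ¬ γ.Realize (x.2 ∘ w)} := by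
  obtain ⟨φ, hφ⟩ := p.2.2
  obtain ⟨⟨M, v⟩, hx⟩ := p.2.1
  rw [← hφ] at hx
  let F : Finset ℕ := φ.freeVarFinset ∪ Finset.univ.image w
  have hF : (φ.freeVarFinset : Set ℕ) ⊆ F := by simp [F]
  have hw : ∀ j, w j ∈ F := by simp [F]
  -- `ρ` says that its free variables are the entries at `w` of a sequence satisfying `φ`
  let ρ : L.Formula (Fin n) := Formula.iExs F
    (φ.restrictFreeVar (fun a => Sum.inr ⟨a, hF a.2⟩) ⊓
      Formula.iInf fun j => (Term.var (Sum.inl j)).equal (Term.var (Sum.inr ⟨w j, hw j⟩)))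
  have hρ : ∀ (N : Theory.ModelType.{u, v, max u v} T) (y : Fin n → N),
      ρ.Realize y ↔ ∃ x : ℕ → N, φ.Realize x ∧ y = x ∘ w := by
    intro N y
    have hiff : ∀ z : F → N, (φ.restrictFreeVar (fun a => Sum.inr ⟨a, hF a.2⟩) ⊓
        Formula.iInf fun j => (Term.var (Sum.inl j)).equal
          (Term.var (Sum.inr ⟨w j, hw j⟩)) : L.Formula (Fin n ⊕ F)).Realize (Sum.elim y z) ↔
        φ.Realize (Function.extend Subtype.val z fun _ => Classical.arbitrary N) ∧
          ∀ j, y j = z ⟨w j, hw j⟩ := by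
      intro z
      rw [Formula.realize_inf, Formula.realize_iInf]
      refine and_congr (BoundedFormula.realize_restrictFreeVar _ fun a => ?_) (by simp)
      exact (Subtype.val_injective.extend_apply z _ ⟨a, hF a.2⟩).symm
    rw [Formula.realize_iExs]
    constructor
    · rintro ⟨z, hz⟩
      obtain ⟨hz, hy⟩ := (hiff z).1 hz
      refine ⟨_, hz, funext fun j => ?_⟩
      rw [hy, Function.comp_apply, ← Subtype.val_injective.extend_apply z _ ⟨w j, hw j⟩]
    · rintro ⟨x, hx, rfl⟩
      refine ⟨fun a => x a, (hiff _).2 ⟨(realize_congr_freeVarFinset fun a ha => ?_).1 hx,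
        fun j => rfl⟩⟩
      exact (Subtype.val_injective.extend_apply (fun a : F => x a) _ ⟨a, hF ha⟩).symm
  obtain ⟨γ, hγ, N, y, hy⟩ := hΓ ρ ⟨M, v ∘ w, (hρ M _).2 ⟨v, hx, rfl⟩⟩
  rw [Formula.realize_inf, hρ, Formula.realize_not] at hy
  obtain ⟨⟨x, hxφ, rfl⟩, hyγ⟩ := hy
  obtain ⟨q, hqp, hq⟩ := p.exists_le (x := ⟨N, x⟩) (γ.relabel w).not (hφ ▸ hxφ) (by
    rwa [Formula.realize_not, Formula.realize_relabel])
  refine ⟨q, hqp, γ, hγ, fun z hz => ?_⟩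
  have := hq z hz
  rwa [Formula.realize_not, Formula.realize_relabel] at this

/-- A descending sequence of conditions has a common element. -/
theorem HenkinCondition.exists_forall_mem {s : ℕ → HenkinCondition T} (hs : Antitone s) :
    ∃ x : PointedModel T, ∀ m, x ∈ (s m).1 := by
  choose x hx using fun m => (s m).2.1
  let U : Ultrafilter ℕ := Filter.hyperfilter ℕ
  let N := (U : Filter ℕ).Product fun m => (x m).1
  have : N ⊨ T := ⟨fun φ hφ => (Ultraproduct.sentence_realize φ).2
    (Filter.Eventually.of_forall fun m => Theory.realize_sentence_of_mem T hφ)⟩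
  refine ⟨⟨Theory.ModelType.of T N, fun k => ((fun m => (x m).2 k : ∀ m, (x m).1) : N)⟩,
    fun m => ?_⟩
  obtain ⟨φ, hφ⟩ := (s m).2.2
  rw [← hφ]
  refine (Ultraproduct.realize_formula_cast φ fun k m => (x m).2 k).2 ?_
  have : ∀ᶠ j in Filter.atTop, φ.Realize (x j).2 := by
    filter_upwards [Filter.eventually_ge_atTop m] with j hj
    have := hs hj (hx j)
    rwa [← hφ] at this
  rw [← Nat.cofinite_eq_atTop] at this
  exact Filter.hyperfilter_le_cofinite this

end Conditions

/-- The range of a sequence is an elementary substructure if every satisfiable formula with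
parameters in the range is satisfied in the range. -/
theorem exists_elementarySubstructure_eq_range {L : FirstOrder.Language.{u, v}} {N : Type*}
    [L.Structure N] (s : ℕ → N)
    (h : ∀ (ψ : L.Formula (Option ℕ)) (a : N), ψ.Realize (fun o => o.elim a s) →
      ∃ k, ψ.Realize fun o => o.elim (s k) s) :
    ∃ S : L.ElementarySubstructure N, (S : Set N) = Set.range s := by
  have hfun : ∀ {n : ℕ} (f : L.Functions n) (x : Fin n → N), (∀ i, x i ∈ Set.range s) →
      Structure.funMap f x ∈ Set.range s := by
    intro n f x hx
    choose w hw using hx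
    obtain rfl : (fun i => s (w i)) = x := funext hw
    obtain ⟨k, hk⟩ := h ((Term.var none).equal (Term.func f fun i => Term.var (some (w i))))
      (Structure.funMap f fun i => s (w i)) (by simp)
    exact ⟨k, by simpa using hk⟩
  let S : L.Substructure N := ⟨Set.range s, fun f x hx => hfun f x hx⟩
  refine ⟨S.toElementarySubstructure fun n φ x a hφ => ?_, rfl⟩
  choose w hw using fun i => (x i).2
  have key : ∀ b : N, (φ.toFormula.relabel
      (Sum.elim Empty.elim (Fin.snoc (fun i => some (w i)) none))).Realize (fun o => o.elim b s) ↔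
      φ.Realize default (Fin.snoc ((↑) ∘ x) b : _ → N) := by
    intro b
    rw [Formula.realize_relabel, BoundedFormula.realize_toFormula, iff_iff_eq]
    congr 1
    · exact Subsingleton.elim _ _
    · funext i
      refine Fin.lastCases ?_ (fun i => ?_) i <;> simp [hw]
  obtain ⟨k, hk⟩ := h _ a ((key a).2 hφ)
  exact ⟨⟨s k, k, rfl⟩, (key (s k)).1 hk⟩

/-- Omitting types theorem for complete theories: a complete consistent theory in a
countable language has a model omitting any family of fewer than `cov K`
non-principal types (each in finitely many free variables). -/
theorem omitting_types_below_covK {L : FirstOrder.Language.{u, v}}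
    (hL : L.card ≤ Cardinal.aleph0)
    (T : L.Theory) (hT : T.IsComplete)
    (ι : Type) (hι : Cardinal.mk ι < covK)
    (n : ι → ℕ) (Γ : (i : ι) → Set (L.Formula (Fin (n i))))
    (hΓ : ∀ i, NonPrincipal T (Γ i)) :
    ∃ M : Theory.ModelType.{u, v, max u v} T,
      ∀ i, ¬ ∃ v : Fin (n i) → M, ∀ γ ∈ Γ i, γ.Realize v := by
  have hsymb : Countable L.Symbols := Cardinal.mk_le_aleph0_iff.1 hL
  have hfun : Countable (Σ l, L.Functions l) :=
    (Sum.inl_injective (β := Σ l, L.Relations l)).countable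
  have hrel : Countable (Σ l, L.Relations l) :=
    (Sum.inr_injective (α := Σ l, L.Functions l)).countable
  have : Countable (HenkinCondition T) :=
    ((Set.countable_range (realizations T)).mono fun S hS => hS.2).to_subtype
  have : Nonempty (HenkinCondition T) := by
    obtain ⟨M⟩ := hT.1
    exact ⟨⟨_, ⟨⟨M, fun _ => Classical.arbitrary M⟩, Formula.realize_top.2 trivial⟩, ⊤, rfl⟩⟩
  obtain ⟨s, hs, hwit, homit⟩ := exists_antitone_forall_mem_of_lt_covK' hι _
    (HenkinCondition.exists_le_witness (T := T)) _
    fun i => HenkinCondition.exists_le_omits (hΓ i)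
  obtain ⟨⟨N, x⟩, hx⟩ := HenkinCondition.exists_forall_mem hs
  obtain ⟨S, hS⟩ := exists_elementarySubstructure_eq_range (L := L) x fun ψ a ha => by
    obtain ⟨m, hm | ⟨k, hk⟩⟩ := hwit ψ
    exacts [absurd ha (hm _ (hx m) a), ⟨k, hk _ (hx m)⟩]
  refine ⟨Theory.ModelType.of T S, fun i hi => ?_⟩
  obtain ⟨y, hy⟩ : ∃ y : Fin (n i) → S, ∀ γ ∈ Γ i, γ.Realize y := hi
  have hrange : ∀ j, ∃ k, x k = y j := fun j => by
    have : (y j : N) ∈ (S : Set N) := (y j).2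
    rwa [hS] at this
  choose w hw using hrange
  obtain ⟨m, γ, hγ, hm⟩ := homit i w
  refine hm _ (hx m) ?_
  have h := (S.subtype.map_formula γ y).2 (hy γ hγ)
  convert h using 1
  exact funext hw
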